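/- Let D=(E,𝓕) be a connected odd normal binary delta-matroid. Then the twist polynomial of D is a monomial if and only if the intersection graph G_D is a single vertex with a loop. -/

import Mathlib

open Finset
open scoped symmDiff

noncomputable section

namespace DeltaMatroid

variable {α : Type*} [DecidableEq α]

/-- A delta-matroid on ground set `E` with feasible sets `F`: `F` is nonempty, consists of
subsets of `E`, and satisfies the symmetric exchange axiom. -/
def IsDeltaMatroid (E : Finset α) (F : Finset (Finset α)) : Prop :=
  F.Nonempty ∧ (∀ X ∈ F, X ⊆ E) ∧
    ∀ X ∈ F, ∀ Y ∈ F, ∀ u ∈ X ∆ Y, ∃ v ∈ X ∆ Y, X ∆ ({u, v} : Finset α) ∈ F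

/-- The twist `D * A` of the feasible sets by a subset `A`. -/
def twist (F : Finset (Finset α)) (A : Finset α) : Finset (Finset α) :=
  F.image fun X => A ∆ X

/-- Maximum cardinality of a feasible set. -/
def maxCard (F : Finset (Finset α)) : ℕ := F.sup Finset.card

/-- Minimum cardinality of a feasible set. -/
def minCard (F : Finset (Finset α)) : ℕ := sInf (Finset.card '' (F : Set (Finset α)))

/-- The width `w(D)`. -/
def width (F : Finset (Finset α)) : ℕ := maxCard F - minCard F

/-- Feasible sets of minimum cardinality. -/
def Fmin (F : Finset (Finset α)) : Finset (Finset α) := F.filter fun X => X.card = minCard F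

/-- Feasible sets of maximum cardinality. -/
def Fmax (F : Finset (Finset α)) : Finset (Finset α) := F.filter fun X => X.card = maxCard F

/-- `e` is a ribbon loop: it lies in no minimum-cardinality feasible set. -/
def IsRibbonLoop (F : Finset (Finset α)) (e : α) : Prop := ∀ X ∈ Fmin F, e ∉ X

/-- A ribbon loop is non-orientable if it is also a ribbon loop of `D * e`. -/
def IsNonorientableRibbonLoop (F : Finset (Finset α)) (e : α) : Prop :=
  IsRibbonLoop F e ∧ IsRibbonLoop (twist F {e}) e

/-- A ribbon loop is orientable if it is not a ribbon loop of `D * e`. -/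
def IsOrientableRibbonLoop (F : Finset (Finset α)) (e : α) : Prop :=
  IsRibbonLoop F e ∧ ¬ IsRibbonLoop (twist F {e}) e

/-- `e` is a loop: it lies in no feasible set. -/
def IsLoop (F : Finset (Finset α)) (e : α) : Prop := ∀ X ∈ F, e ∉ X

/-- `e` is a coloop: it lies in every feasible set. -/
def IsColoop (F : Finset (Finset α)) (e : α) : Prop := ∀ X ∈ F, e ∈ X

/-- Contraction `D / e`. -/
def contract (F : Finset (Finset α)) (e : α) : Finset (Finset α) :=
  if ∀ X ∈ F, e ∉ X then F
  else (F.filter fun X => e ∈ X).image fun X => X.erase e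

/-- Deletion `D \ e`. -/
def delete (F : Finset (Finset α)) (e : α) : Finset (Finset α) :=
  if ∀ X ∈ F, e ∈ X then F.image fun X => X.erase e
  else F.filter fun X => e ∉ X

/-- Deletion of every element of `A` (in some order; the order does not matter). -/
def deleteSet (F : Finset (Finset α)) (A : Finset α) : Finset (Finset α) :=
  A.toList.foldl delete F

/-- The restriction `D |_A = D \ (E \ A)` of a delta-matroid with ground set `E`. -/
def restrict (F : Finset (Finset α)) (E A : Finset α) : Finset (Finset α) :=
  deleteSet F (E \ A)

/-- Feasible sets of the direct sum `D ⊕ D'`. -/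
def directSum (F G : Finset (Finset α)) : Finset (Finset α) :=
  (F ×ˢ G).image fun p => p.1 ∪ p.2

/-- A delta-matroid is connected if it is not a direct sum of two delta-matroids on
nonempty ground sets. -/
def IsConnected (E : Finset α) (F : Finset (Finset α)) : Prop :=
  ¬ ∃ (E₁ E₂ : Finset α) (F₁ F₂ : Finset (Finset α)),
      E₁.Nonempty ∧ E₂.Nonempty ∧ Disjoint E₁ E₂ ∧ E = E₁ ∪ E₂ ∧
      IsDeltaMatroid E₁ F₁ ∧ IsDeltaMatroid E₂ F₂ ∧ F = directSum F₁ F₂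

/-- A delta-matroid is even if all feasible sets have the same parity of cardinality. -/
def IsEvenDM (F : Finset (Finset α)) : Prop :=
  ∀ X ∈ F, ∀ Y ∈ F, X.card % 2 = Y.card % 2

variable {ι : Type*} [Fintype ι] [DecidableEq ι]

/-- The feasible sets of `D(C)`: subsets `A` whose principal submatrix `C[A]` is nonsingular
(over `GF(2)`, i.e. has nonzero determinant); `C[∅]` is nonsingular by convention. -/
def binaryFeasible (C : Matrix ι ι (ZMod 2)) : Finset (Finset ι) :=
  Finset.univ.filter fun A =>
    (C.submatrix (fun x : {a // a ∈ A} => (x : ι)) (fun x : {a // a ∈ A} => (x : ι))).det ≠ 0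

/-- The (simple-graph part of the) intersection graph `G_D` of a normal binary delta-matroid
`D(C)`: distinct `u, v` adjacent iff `C u v = 1`.  Loops are recorded by the diagonal of `C`. -/
def interGraph (C : Matrix ι ι (ZMod 2)) : SimpleGraph ι :=
  SimpleGraph.fromRel fun u v => C u v = 1


/-- The kernel of the principal submatrix `C[A]`, as a space of vectors supported in `A`. -/
def KK (C : Matrix ι ι (ZMod 2)) (A : Finset ι) : Submodule (ZMod 2) (ι → ZMod 2) where
  carrier := {x | (∀ i, i ∉ A → x i = 0) ∧ ∀ i ∈ A, C.mulVec x i = 0}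
  add_mem' := by
    rintro x y ⟨h1, h2⟩ ⟨h3, h4⟩
    refine ⟨fun i hi => ?_, fun i hi => ?_⟩
    · simp [h1 i hi, h3 i hi]
    · rw [Matrix.mulVec_add]; simp [h2 i hi, h4 i hi]
  zero_mem' := by
    refine ⟨fun i hi => rfl, fun i hi => ?_⟩
    simp
  smul_mem' := by
    rintro c x ⟨h1, h2⟩
    refine ⟨fun i hi => ?_, fun i hi => ?_⟩
    · simp [h1 i hi]
    · rw [Matrix.mulVec_smul]; simp [h2 i hi]

theorem mem_KK {C : Matrix ι ι (ZMod 2)} {A : Finset ι} {x : ι → ZMod 2} :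
    x ∈ KK C A ↔ (∀ i, i ∉ A → x i = 0) ∧ ∀ i ∈ A, C.mulVec x i = 0 := Iff.rfl

theorem zmod2_ne {a : ZMod 2} : a ≠ 0 ↔ a = 1 := by
  revert a; decide

theorem sub_mulVec (C : Matrix ι ι (ZMod 2)) (A : Finset ι) (x : ι → ZMod 2)
    (hx : ∀ i, i ∉ A → x i = 0) (i : {a // a ∈ A}) :
    (C.submatrix (fun x : {a // a ∈ A} => (x : ι)) (fun x : {a // a ∈ A} => (x : ι))).mulVec
      (fun j => x j) i = C.mulVec x i := by
  simp only [Matrix.mulVec, dotProduct, Matrix.submatrix_apply]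
  rw [Finset.sum_coe_sort A (fun j => C i j * x j)]
  apply Finset.sum_subset (Finset.subset_univ _)
  intro j _ hj
  simp [hx j hj]

theorem feas_iff (C : Matrix ι ι (ZMod 2)) (A : Finset ι) :
    A ∈ binaryFeasible C ↔ ∀ x ∈ KK C A, x = 0 := by
  unfold binaryFeasible
  simp only [Finset.mem_filter, Finset.mem_univ, true_and]
  rw [ne_eq, ← Matrix.exists_mulVec_eq_zero_iff]
  push Not
  constructor
  · intro h x hx
    by_contra hne
    apply h (fun j => x j)
    · intro h0
      apply hne
      funext i
      by_cases hi : i ∈ A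
      · exact congrFun h0 ⟨i, hi⟩
      · exact hx.1 i hi
    · funext i
      rw [sub_mulVec C A x hx.1]
      exact hx.2 i i.2
  · intro h w hw h0
    apply hw
    have hsupp : ∀ i, i ∉ A → (fun i => if h : i ∈ A then w ⟨i, h⟩ else 0) i = 0 := by
      intro i hi
      simp [hi]
    have hw' : (fun j : {a // a ∈ A} => (fun i => if h : i ∈ A then w ⟨i, h⟩ else 0) (j : ι)) = w := by
      funext j
      simp
    have := h (fun i => if h : i ∈ A then w ⟨i, h⟩ else 0) ⟨hsupp, fun i hi => by
      have h1 := sub_mulVec C A _ hsupp ⟨i, hi⟩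
      rw [hw', h0] at h1
      exact h1.symm⟩
    rw [← hw']
    rw [this]
    rfl

/-- Nullity of `C[A]`. -/
def dd (C : Matrix ι ι (ZMod 2)) (A : Finset ι) : ℕ := Module.finrank (ZMod 2) (KK C A)

theorem dd_eq_zero_iff (C : Matrix ι ι (ZMod 2)) (A : Finset ι) :
    dd C A = 0 ↔ A ∈ binaryFeasible C := by
  rw [feas_iff, dd, Submodule.finrank_eq_zero, Submodule.eq_bot_iff]

theorem pairing (C : Matrix ι ι (ZMod 2)) (hC : C.IsSymm) (x y : ι → ZMod 2) :
    ∑ i, x i * C.mulVec y i = ∑ i, C.mulVec x i * y i := by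
  change dotProduct x (C.mulVec y) = dotProduct (C.mulVec x) y
  rw [Matrix.dotProduct_mulVec, ← Matrix.mulVec_transpose, hC.eq]

theorem KK_erase (C : Matrix ι ι (ZMod 2)) (hC : C.IsSymm) (A : Finset ι) (u : ι) (hu : u ∈ A)
    (x : ι → ZMod 2) (hx : x ∈ KK C A) (hxu : x u ≠ 0) (y : ι → ZMod 2) :
    y ∈ KK C (A.erase u) ↔ y ∈ KK C A ∧ y u = 0 := by
  constructor
  · rintro ⟨h1, h2⟩
    have hyu : y u = 0 := h1 u (by simp)
    have hsupp : ∀ i, i ∉ A → y i = 0 := fun i hi => h1 i (fun h => hi (Finset.mem_of_mem_erase h))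
    refine ⟨⟨hsupp, fun i hi => ?_⟩, hyu⟩
    by_cases hiu : i = u
    · subst hiu
      have hp := pairing C hC x y
      rw [Finset.sum_eq_single i, Finset.sum_eq_zero] at hp
      · exact (mul_eq_zero.mp hp).resolve_left hxu
      · intro j _
        by_cases hj : j ∈ A
        · rw [hx.2 j hj, zero_mul]
        · rw [hsupp j hj, mul_zero]
      · intro j _ hji
        by_cases hj : j ∈ A
        · rw [h2 j (Finset.mem_erase.mpr ⟨hji, hj⟩), mul_zero]
        · rw [hx.1 j hj, zero_mul]
      · simp
    · exact h2 i (Finset.mem_erase.mpr ⟨hiu, hi⟩)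
  · rintro ⟨⟨h1, h2⟩, h3⟩
    refine ⟨fun i hi => ?_, fun i hi => h2 i (Finset.mem_of_mem_erase hi)⟩
    by_cases hiu : i = u
    · subst hiu; exact h3
    · exact h1 i (fun h => hi (Finset.mem_erase.mpr ⟨hiu, h⟩))

theorem dd_erase (C : Matrix ι ι (ZMod 2)) (hC : C.IsSymm) (A : Finset ι) (u : ι) (hu : u ∈ A)
    (x : ι → ZMod 2) (hx : x ∈ KK C A) (hxu : x u ≠ 0) :
    dd C (A.erase u) + 1 = dd C A := by
  have hx0 : x ≠ 0 := by rintro rfl; exact hxu rfl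
  have hsup : KK C (A.erase u) ⊔ Submodule.span (ZMod 2) {x} = KK C A := by
    apply le_antisymm
    · refine sup_le (fun y hy => ((KK_erase C hC A u hu x hx hxu y).1 hy).1) ?_
      rw [Submodule.span_singleton_le_iff_mem]
      exact hx
    · intro y hy
      rw [Submodule.mem_sup]
      refine ⟨y - (y u) • x, ?_, (y u) • x, Submodule.smul_mem _ _ (Submodule.mem_span_singleton_self x), by simp⟩
      rw [KK_erase C hC A u hu x hx hxu]
      refine ⟨Submodule.sub_mem _ hy (Submodule.smul_mem _ _ hx), ?_⟩
      simp [zmod2_ne.1 hxu]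
  have hinf : KK C (A.erase u) ⊓ Submodule.span (ZMod 2) {x} = ⊥ := by
    rw [Submodule.eq_bot_iff]
    rintro y ⟨hy1, hy2⟩
    obtain ⟨c, rfl⟩ := Submodule.mem_span_singleton.1 hy2
    have := ((KK_erase C hC A u hu x hx hxu _).1 hy1).2
    simp [zmod2_ne.1 hxu] at this
    simp [this]
  have h := Submodule.finrank_sup_add_finrank_inf_eq (KK C (A.erase u)) (Submodule.span (ZMod 2) {x})
  rw [hsup, hinf, finrank_span_singleton hx0] at h
  simp at h
  exact h.symm

theorem dd_mono_of (C : Matrix ι ι (ZMod 2)) (A B : Finset ι) (h : KK C A ≤ KK C B) :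
    dd C A ≤ dd C B := Submodule.finrank_mono h

theorem exists_feas (C : Matrix ι ι (ZMod 2)) (hC : C.IsSymm) (A : Finset ι) :
    ∃ X ∈ binaryFeasible C, X ⊆ A ∧ (A \ X).card = dd C A := by
  induction A using Finset.strongInduction with
  | H A ih =>
    by_cases hA : A ∈ binaryFeasible C
    · exact ⟨A, hA, subset_rfl, by rw [(dd_eq_zero_iff C A).2 hA]; simp⟩
    · have hA' := hA
      rw [feas_iff] at hA'
      push Not at hA'
      obtain ⟨x, hx, hx0⟩ := hA'
      obtain ⟨u, hu⟩ := Function.ne_iff.1 hx0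
      have huA : u ∈ A := by
        by_contra h
        exact hu (hx.1 u h)
      obtain ⟨X, hX, hXA, hc⟩ := ih (A.erase u) (Finset.erase_ssubset huA)
      refine ⟨X, hX, hXA.trans (Finset.erase_subset _ _), ?_⟩
      rw [← dd_erase C hC A u huA x hx hu, ← hc]
      have huX : u ∉ X := fun h => by simpa using hXA h
      have : A \ X = insert u (A.erase u \ X) := by
        ext i
        by_cases hi : i = u
        · subst hi; simp [huA, huX]
        · simp [hi]
      rw [this, Finset.card_insert_of_notMem]
      simp

theorem dd_le (C : Matrix ι ι (ZMod 2)) (A X : Finset ι) (hX : X ∈ binaryFeasible C) :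
    dd C A ≤ (A ∆ X).card := by
  let f : (ι → ZMod 2) →ₗ[ZMod 2] ({i // i ∈ A ∆ X} → ZMod 2) :=
    { toFun := fun x i => if (i : ι) ∈ A then x i else C.mulVec x i
      map_add' := by
        intro x y; funext i; simp only [Matrix.mulVec_add, Pi.add_apply]; split_ifs <;> rfl
      map_smul' := by
        intro c x; funext i
        simp only [Matrix.mulVec_smul, Pi.smul_apply, RingHom.id_apply]; split_ifs <;> rfl }
  have hinj : Function.Injective (f.domRestrict (KK C A)) := by
    rw [← LinearMap.ker_eq_bot, Submodule.eq_bot_iff]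
    rintro ⟨x, hx⟩ hfx
    have hfx' : ∀ i (hi : i ∈ A ∆ X), (if i ∈ A then x i else C.mulVec x i) = 0 :=
      fun i hi => congrFun (LinearMap.mem_ker.1 hfx) ⟨i, hi⟩
    have : x = 0 := by
      refine (feas_iff C X).1 hX x ⟨fun i hi => ?_, fun i hi => ?_⟩
      · by_cases hA : i ∈ A
        · have := hfx' i (by simp [Finset.mem_symmDiff, hi, hA])
          simpa [hA] using this
        · exact hx.1 i hA
      · by_cases hA : i ∈ A
        · exact hx.2 i hA
        · have := hfx' i (by simp [Finset.mem_symmDiff, hi, hA])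
          simpa [hA] using this
    simp [this]
  have := LinearMap.finrank_le_finrank_of_injective hinj
  simpa [dd] using this

theorem minCard_twist (C : Matrix ι ι (ZMod 2)) (hC : C.IsSymm) (A : Finset ι) :
    minCard (twist (binaryFeasible C) A) = dd C A := by
  unfold minCard
  apply IsLeast.csInf_eq
  constructor
  · obtain ⟨X, hX, hXA, hc⟩ := exists_feas C hC A
    refine ⟨A ∆ X, ?_, ?_⟩
    · simp only [twist, Finset.mem_coe, Finset.mem_image]
      exact ⟨X, hX, rfl⟩
    · rw [← hc]
      congr 1
      rw [symmDiff_def]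
      simp [Finset.sdiff_eq_empty_iff_subset.2 hXA]
  · rintro _ ⟨Y, hY, rfl⟩
    simp only [twist, Finset.mem_coe, Finset.mem_image] at hY
    obtain ⟨X, hX, rfl⟩ := hY
    exact dd_le C A X hX

theorem card_compl_symm (A X : Finset ι) : (A ∆ X).card + (Aᶜ ∆ X).card = Fintype.card ι := by
  have : Aᶜ ∆ X = (A ∆ X)ᶜ := by
    ext i
    simp only [Finset.mem_symmDiff, Finset.mem_compl]
    tauto
  rw [this]
  exact Finset.card_add_card_compl _

theorem maxCard_twist (C : Matrix ι ι (ZMod 2)) (hC : C.IsSymm) (A : Finset ι) :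
    maxCard (twist (binaryFeasible C) A) + dd C Aᶜ = Fintype.card ι := by
  unfold maxCard
  obtain ⟨X, hX, hXA, hc⟩ := exists_feas C hC Aᶜ
  have h1 : (Aᶜ ∆ X).card = dd C Aᶜ := by
    rw [← hc]
    congr 1
    rw [symmDiff_def]
    simp [Finset.sdiff_eq_empty_iff_subset.2 hXA]
  have h2 : (A ∆ X).card ≤ (twist (binaryFeasible C) A).sup Finset.card :=
    Finset.le_sup (f := Finset.card) (by
      simp only [twist, Finset.mem_image]
      exact ⟨X, hX, rfl⟩)
  have h3 : (twist (binaryFeasible C) A).sup Finset.card ≤ (A ∆ X).card := by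
    apply Finset.sup_le
    intro Y hY
    simp only [twist, Finset.mem_image] at hY
    obtain ⟨Z, hZ, rfl⟩ := hY
    have := dd_le C Aᶜ Z hZ
    have := card_compl_symm A Z
    have := card_compl_symm A X
    omega
  have := card_compl_symm A X
  omega

theorem width_twist (C : Matrix ι ι (ZMod 2)) (hC : C.IsSymm) (A : Finset ι) :
    width (twist (binaryFeasible C) A) + dd C A + dd C Aᶜ = Fintype.card ι := by
  have h1 := minCard_twist C hC A
  have h2 := maxCard_twist C hC A
  have h3 : minCard (twist (binaryFeasible C) A) ≤ maxCard (twist (binaryFeasible C) A) := by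
    obtain ⟨X, hX, hXA, hc⟩ := exists_feas C hC A
    have h4 := dd_le C A X hX
    have h5 := dd_le C Aᶜ X hX
    have h6 := card_compl_symm A X
    omega
  unfold width
  omega

/-- The coordinate that must vanish for the feasibility test of `X`. -/
def rho (C : Matrix ι ι (ZMod 2)) (X : Finset ι) (x : ι → ZMod 2) (i : ι) : ZMod 2 :=
  if i ∈ X then C.mulVec x i else x i

/-- The complementary coordinate. -/
def sig (C : Matrix ι ι (ZMod 2)) (X : Finset ι) (x : ι → ZMod 2) (i : ι) : ZMod 2 :=
  if i ∈ X then x i else C.mulVec x i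

theorem feas_iff_rho (C : Matrix ι ι (ZMod 2)) (X : Finset ι) :
    X ∈ binaryFeasible C ↔ ∀ x, (∀ i, rho C X x i = 0) → x = 0 := by
  rw [feas_iff]
  constructor
  · intro h x hx
    refine h x ⟨fun i hi => ?_, fun i hi => ?_⟩
    · simpa [rho, hi] using hx i
    · simpa [rho, hi] using hx i
  · intro h x hx
    refine h x fun i => ?_
    by_cases hi : i ∈ X
    · simpa [rho, hi] using hx.2 i hi
    · simpa [rho, hi] using hx.1 i hi

theorem rho_symmDiff (C : Matrix ι ι (ZMod 2)) (X Z : Finset ι) (x : ι → ZMod 2) (i : ι) :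
    rho C (X ∆ Z) x i = if i ∈ Z then sig C X x i else rho C X x i := by
  by_cases h1 : i ∈ X <;> by_cases h2 : i ∈ Z <;> simp [rho, sig, Finset.mem_symmDiff, h1, h2]

theorem rho_sub (C : Matrix ι ι (ZMod 2)) (X : Finset ι) (x y : ι → ZMod 2) (i : ι) :
    rho C X (x - y) i = rho C X x i - rho C X y i := by
  by_cases h1 : i ∈ X <;> simp [rho, h1, Matrix.mulVec_sub]

theorem rho_surj (C : Matrix ι ι (ZMod 2)) (X : Finset ι) (hX : X ∈ binaryFeasible C)
    (w : ι → ZMod 2) : ∃ x, ∀ i, rho C X x i = w i := by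
  rw [feas_iff_rho] at hX
  have hinj : Function.Injective (rho C X) := by
    intro x y hxy
    rw [← sub_eq_zero]
    apply hX
    intro i
    rw [rho_sub, hxy, sub_self]
  obtain ⟨x, hx⟩ := (Finite.injective_iff_surjective.1 hinj) w
  exact ⟨x, fun i => congrFun hx i⟩

theorem pairing_rho (C : Matrix ι ι (ZMod 2)) (hC : C.IsSymm) (X : Finset ι) (x y : ι → ZMod 2) :
    ∑ i, (rho C X x i * sig C X y i + sig C X x i * rho C X y i) = 0 := by
  have h := pairing C hC x y
  have h2 : ∑ i, (x i * C.mulVec y i + C.mulVec x i * y i) = 0 := by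
    rw [Finset.sum_add_distrib, h, CharTwo.add_self_eq_zero]
  rw [← h2]
  apply Finset.sum_congr rfl
  intro i _
  by_cases hi : i ∈ X
  · simp only [rho, sig, hi, if_true]; ring
  · simp only [rho, sig, hi, if_false]

theorem exchange (C : Matrix ι ι (ZMod 2)) (hC : C.IsSymm) (X : Finset ι)
    (hX : X ∈ binaryFeasible C) (Y : Finset ι) (hY : Y ∈ binaryFeasible C) (u : ι)
    (hu : u ∈ X ∆ Y) : ∃ v ∈ X ∆ Y, X ∆ ({u, v} : Finset ι) ∈ binaryFeasible C := by
  obtain ⟨p, hp⟩ := rho_surj C X hX (Pi.single u 1)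
  have hXr := (feas_iff_rho C X).1 hX
  have hpu : rho C X p u = 1 := by rw [hp]; simp
  have hpi : ∀ i, i ≠ u → rho C X p i = 0 := fun i hi => by rw [hp]; simp [hi]
  -- a vector whose only possibly nonzero coordinate is `u`
  have key : ∀ z, (∀ i, i ≠ u → rho C X z i = 0) → z = 0 ∨ z = p := by
    intro z hz
    by_cases h : rho C X z u = 0
    · left
      apply hXr
      intro i
      by_cases hi : i = u
      · rw [hi, h]
      · exact hz i hi
    · right
      rw [← sub_eq_zero]
      apply hXr
      intro i
      rw [rho_sub]
      by_cases hi : i = u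
      · rw [hi, hpu, zmod2_ne.1 h, sub_self]
      · rw [hz i hi, hpi i hi, sub_self]
  by_cases huu : sig C X p u = 0
  · have hex : ∃ v ∈ X ∆ Y, sig C X p v ≠ 0 := by
      by_contra hcon
      push Not at hcon
      have hp0 : p = 0 := by
        apply (feas_iff_rho C Y).1 hY
        intro i
        have hYe : Y = X ∆ (X ∆ Y) := by rw [symmDiff_symmDiff_cancel_left]
        rw [hYe, rho_symmDiff]
        split_ifs with hi
        · exact hcon i hi
        · exact hpi i (fun h => hi (h ▸ hu))
      rw [hp0] at hpu
      simp [rho] at hpu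
    obtain ⟨v, hv, hpv⟩ := hex
    have hvu : v ≠ u := fun h => hpv (h ▸ huu)
    refine ⟨v, hv, ?_⟩
    rw [feas_iff_rho]
    intro z hz
    have hzu : sig C X z u = 0 := by have := hz u; simpa [rho_symmDiff] using this
    have hzv : sig C X z v = 0 := by have := hz v; simpa [rho_symmDiff] using this
    have hzi : ∀ i, i ≠ u → i ≠ v → rho C X z i = 0 := by
      intro i h1 h2
      have := hz i
      simpa [rho_symmDiff, h1, h2] using this
    have hpair := pairing_rho C hC X p z
    rw [Finset.sum_eq_single v] at hpair
    · rw [hzv, mul_zero, zero_add] at hpair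
      have hzv0 := (mul_eq_zero.1 hpair).resolve_left hpv
      rcases key z (fun i hi => by
        by_cases hiv : i = v
        · rw [hiv, hzv0]
        · exact hzi i hi hiv) with h | h
      · exact h
      · rw [h] at hzv
        exact absurd hzv hpv
    · intro i _ hiv
      by_cases hi : i = u
      · rw [hi, hzu, huu]; simp
      · rw [hpi i hi, hzi i hi hiv]; simp
    · simp
  · refine ⟨u, hu, ?_⟩
    rw [feas_iff_rho]
    intro z hz
    have hzu : sig C X z u = 0 := by have := hz u; simpa [rho_symmDiff] using this
    rcases key z (fun i hi => by have := hz i; simpa [rho_symmDiff, hi] using this) with h | h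
    · exact h
    · rw [h] at hzu
      exact absurd hzu huu

theorem empty_feas (C : Matrix ι ι (ZMod 2)) : ∅ ∈ binaryFeasible C := by
  rw [feas_iff]
  intro x hx
  funext i
  exact hx.1 i (by simp)

theorem isDM_filter (C : Matrix ι ι (ZMod 2)) (hC : C.IsSymm) (E : Finset ι) :
    IsDeltaMatroid E ((binaryFeasible C).filter fun X => X ⊆ E) := by
  refine ⟨⟨∅, by simp [empty_feas]⟩, fun X hX => (Finset.mem_filter.1 hX).2, ?_⟩
  intro X hX Y hY u hu
  rw [Finset.mem_filter] at hX hY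
  obtain ⟨v, hv, h⟩ := exchange C hC X hX.1 Y hY.1 u hu
  refine ⟨v, hv, Finset.mem_filter.2 ⟨h, ?_⟩⟩
  have hE : ∀ i ∈ X ∆ Y, i ∈ E := by
    intro i hi
    rcases Finset.mem_symmDiff.1 hi with h | h
    · exact hX.2 h.1
    · exact hY.2 h.1
  intro i hi
  rcases Finset.mem_symmDiff.1 hi with h | h
  · exact hX.2 h.1
  · have := h.1
    simp only [Finset.mem_insert, Finset.mem_singleton] at this
    rcases this with rfl | rfl
    · exact hE _ hu
    · exact hE _ hv

/-- An alternating matrix of odd size is singular. -/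
theorem det_alt_odd {κ : Type*} [Fintype κ] [DecidableEq κ] (M : Matrix κ κ (ZMod 2))
    (hM : M.IsSymm) (hd : ∀ i, M i i = 0) (hodd : Odd (Fintype.card κ)) : M.det = 0 := by
  rw [Matrix.det_apply']
  have hs : ∀ σ : Equiv.Perm κ, (((Equiv.Perm.sign σ : ℤˣ) : ℤ) : ZMod 2) = 1 := by
    intro σ
    rcases Int.units_eq_one_or (Equiv.Perm.sign σ) with h | h <;> rw [h] <;> decide
  have hprod : ∀ σ : Equiv.Perm κ, ∏ i, M (σ⁻¹ i) i = ∏ i, M (σ i) i := by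
    intro σ
    rw [← Equiv.prod_comp σ (fun i => M (σ⁻¹ i) i)]
    apply Finset.prod_congr rfl
    intro i _
    have h1 : σ⁻¹ (σ i) = i := by simp
    rw [h1]
    exact hM.apply _ _
  apply Finset.sum_involution (fun σ _ => σ⁻¹)
  · intro σ _
    rw [hs, hs, hprod, CharTwo.add_self_eq_zero]
  · intro σ _ hne heq
    apply hne
    have : Fact (Nat.Prime 2) := ⟨Nat.prime_two⟩
    have hsq : σ ^ 2 ^ 1 = 1 := by
      rw [pow_one, pow_two]
      nth_rewrite 1 [← heq]
      simp
    obtain ⟨i, hi⟩ := Equiv.Perm.exists_fixed_point_of_prime (p := 2) (n := 1)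
      (by rw [← even_iff_two_dvd]; exact Nat.not_even_iff_odd.2 hodd) hsq
    rw [Finset.prod_eq_zero (Finset.mem_univ i), mul_zero]
    rw [hi, hd]
  · intro σ _; simp
  · intro σ _; exact Finset.mem_univ _

theorem exists_loop (C : Matrix ι ι (ZMod 2)) (hC : C.IsSymm)
    (hodd : ¬ IsEvenDM (binaryFeasible C)) : ∃ v, C v v = 1 := by
  by_contra hcon
  push Not at hcon
  have hd : ∀ i, C i i = 0 := fun i => by
    by_contra h
    exact hcon i (zmod2_ne.1 h)
  have hev : ∀ X ∈ binaryFeasible C, X.card % 2 = 0 := by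
    intro X hX
    by_contra h
    unfold binaryFeasible at hX
    apply (Finset.mem_filter.1 hX).2
    apply det_alt_odd
    · exact hC.submatrix _
    · intro i; exact hd _
    · rw [Fintype.card_coe, Nat.odd_iff]; omega
  apply hodd
  intro X hX Y hY
  rw [hev X hX, hev Y hY]

theorem no_neighbor (C : Matrix ι ι (ZMod 2)) (hC : C.IsSymm)
    (hconst : ∀ A, dd C A + dd C Aᶜ = dd C Finset.univ) (v : ι) (hv : C v v = 1) (u : ι)
    (huv : u ≠ v) : C v u = 0 := by
  by_contra hne
  have hvu := zmod2_ne.1 hne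
  have huv1 : C u v = 1 := by rw [← hvu]; exact hC.apply _ _
  have hE : ∀ i : ι, ({i} : Finset ι)ᶜ = Finset.univ.erase i := by
    intro i; ext j; simp
  have hE2 : ({u, v} : Finset ι)ᶜ = (Finset.univ.erase v).erase u := by
    ext j; simp
  have hsupp1 : ∀ (i : ι) (x : ι → ZMod 2), (∀ j, j ∉ ({i} : Finset ι) → x j = 0) →
      ∀ j, C.mulVec x j = C j i * x i := by
    intro i x hx j
    simp only [Matrix.mulVec, dotProduct]
    rw [Finset.sum_eq_single i]
    · intro k _ hk
      rw [hx k (by simpa using hk), mul_zero]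
    · simp
  have hsupp2 : ∀ (x : ι → ZMod 2), (∀ j, j ∉ ({u, v} : Finset ι) → x j = 0) →
      ∀ j, C.mulVec x j = C j u * x u + C j v * x v := by
    intro x hx j
    simp only [Matrix.mulVec, dotProduct]
    rw [← Finset.sum_subset (Finset.subset_univ ({u, v} : Finset ι)), Finset.sum_pair huv]
    intro k _ hk
    rw [hx k hk, mul_zero]
  have hloop : ∀ i, C i i = 1 → dd C {i} = 0 := by
    intro i hi
    rw [dd_eq_zero_iff, feas_iff]
    intro x hx
    have h1 := hx.2 i (by simp)
    rw [hsupp1 i x hx.1, hi, one_mul] at h1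
    funext j
    by_cases hj : j = i
    · rw [hj, h1]; rfl
    · exact hx.1 j (by simpa using hj)
  have hcv := hconst {v}
  have hcu := hconst {u}
  have hcuv := hconst {u, v}
  rw [hE, hloop v hv] at hcv
  rw [hE] at hcu
  rw [hE2] at hcuv
  have hkerv : ∀ x ∈ KK C Finset.univ, x v = 0 := by
    intro x hx
    by_contra h
    have := dd_erase C hC Finset.univ v (Finset.mem_univ v) x hx h
    omega
  by_cases hu : C u u = 1
  · rw [hloop u hu] at hcu
    have hkeru : ∀ x ∈ KK C Finset.univ, x u = 0 := by
      intro x hx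
      by_contra h
      have := dd_erase C hC Finset.univ u (Finset.mem_univ u) x hx h
      omega
    have hle : dd C Finset.univ ≤ dd C ((Finset.univ.erase v).erase u) := by
      apply dd_mono_of
      intro x hx
      refine ⟨fun i hi => ?_, fun i hi => hx.2 i (Finset.mem_univ i)⟩
      by_cases hiu : i = u
      · rw [hiu]; exact hkeru x hx
      · by_cases hiv : i = v
        · rw [hiv]; exact hkerv x hx
        · exact absurd hi (by simp [hiu, hiv])
    have hx : (Pi.single u 1 + Pi.single v 1 : ι → ZMod 2) ∈ KK C {u, v} := by
      have hs : ∀ j, j ∉ ({u, v} : Finset ι) → (Pi.single u 1 + Pi.single v 1 : ι → ZMod 2) j = 0 := by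
        intro j hj
        simp only [Finset.mem_insert, Finset.mem_singleton, not_or] at hj
        simp [hj.1, hj.2]
      refine ⟨hs, fun i hi => ?_⟩
      rw [hsupp2 _ hs]
      simp only [Finset.mem_insert, Finset.mem_singleton] at hi
      rcases hi with rfl | rfl
      · simp [hu, huv1, huv, huv.symm, CharTwo.add_self_eq_zero]
      · simp [hv, hvu, huv, huv.symm, CharTwo.add_self_eq_zero]
    have := dd_erase C hC {u, v} u (by simp) _ hx (by simp [huv])
    omega
  · have hu0 : C u u = 0 := by
      by_contra h
      exact hu (zmod2_ne.1 h)
    have hduv : dd C {u, v} = 0 := by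
      rw [dd_eq_zero_iff, feas_iff]
      intro x hx
      have h1 := hx.2 u (by simp)
      have h2 := hx.2 v (by simp)
      rw [hsupp2 x hx.1, hu0, huv1] at h1
      rw [hsupp2 x hx.1, hv, hvu] at h2
      have hxv : x v = 0 := by simpa using h1
      have hxu : x u = 0 := by simpa [hxv] using h2
      funext j
      by_cases hj : j = u
      · rw [hj, hxu]; rfl
      · by_cases hj' : j = v
        · rw [hj', hxv]; rfl
        · exact hx.1 j (by simp [hj, hj'])
    have hdu : dd C {u} ≠ 0 := by
      rw [ne_eq, dd_eq_zero_iff, feas_iff]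
      intro h
      have hs : ∀ j, j ∉ ({u} : Finset ι) → (Pi.single u 1 : ι → ZMod 2) j = 0 := by
        intro j hj
        simp only [Finset.mem_singleton] at hj
        simp [hj]
      have := congrFun (h (Pi.single u 1) ⟨hs, fun i hi => by
        rw [hsupp1 u _ hs]
        rw [Finset.mem_singleton.1 hi, hu0, zero_mul]⟩) u
      simp at this
    have hk : ∃ k ∈ KK C Finset.univ, k u ≠ 0 := by
      by_contra hcon
      push Not at hcon
      have : dd C Finset.univ ≤ dd C (Finset.univ.erase u) := by
        apply dd_mono_of
        intro x hx
        refine ⟨fun i hi => ?_, fun i hi => hx.2 i (Finset.mem_univ i)⟩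
        have : i = u := by simpa using hi
        rw [this]; exact hcon x hx
      omega
    obtain ⟨k, hk, hku⟩ := hk
    have hk' : k ∈ KK C (Finset.univ.erase v) := by
      refine ⟨fun i hi => ?_, fun i hi => hk.2 i (Finset.mem_univ i)⟩
      have : i = v := by simpa using hi
      rw [this]; exact hkerv k hk
    have := dd_erase C hC (Finset.univ.erase v) u (by simp [huv]) k hk' hku
    omega

theorem isolated_loop_sum (C : Matrix ι ι (ZMod 2)) (hC : C.IsSymm) (v : ι) (hv : C v v = 1)
    (hiso : ∀ u, u ≠ v → C v u = 0) :
    binaryFeasible C = directSum ((binaryFeasible C).filter fun X => X ⊆ {v})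
      ((binaryFeasible C).filter fun X => X ⊆ Finset.univ.erase v) := by
  have hmv : ∀ x : ι → ZMod 2, C.mulVec x v = x v := by
    intro x
    simp only [Matrix.mulVec, dotProduct]
    rw [Finset.sum_eq_single v]
    · rw [hv, one_mul]
    · intro j _ hj
      rw [hiso j hj, zero_mul]
    · simp
  have hmain : ∀ X, v ∉ X → (insert v X ∈ binaryFeasible C ↔ X ∈ binaryFeasible C) := by
    intro X hvX
    rw [feas_iff, feas_iff]
    constructor
    · intro h x hx
      refine h x ⟨fun i hi => hx.1 i (fun h => hi (Finset.mem_insert_of_mem h)), fun i hi => ?_⟩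
      rcases Finset.mem_insert.1 hi with rfl | hi
      · rw [hmv]; exact hx.1 _ hvX
      · exact hx.2 i hi
    · intro h x hx
      refine h x ⟨fun i hi => ?_, fun i hi => hx.2 i (Finset.mem_insert_of_mem hi)⟩
      by_cases hiv : i = v
      · rw [hiv, ← hmv x]; exact hx.2 v (by simp)
      · exact hx.1 i (by simp [hi, hiv])
  ext X
  simp only [directSum, Finset.mem_image, Finset.mem_product, Finset.mem_filter, Prod.exists]
  have hnot : ∀ Z : Finset ι, Z ⊆ Finset.univ.erase v → v ∉ Z := fun Z hZ h => by
    simpa using hZ h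
  constructor
  · intro hX
    by_cases hvX : v ∈ X
    · refine ⟨{v}, X.erase v, ⟨⟨?_, subset_rfl⟩, ?_, ?_⟩, ?_⟩
      · have := (hmain ∅ (by simp)).2 (empty_feas C)
        simpa using this
      · rw [← hmain _ (Finset.notMem_erase v X), Finset.insert_erase hvX]; exact hX
      · exact Finset.erase_subset_erase _ (Finset.subset_univ _)
      · rw [← Finset.insert_eq, Finset.insert_erase hvX]
    · refine ⟨∅, X, ⟨⟨empty_feas C, by simp⟩, hX, ?_⟩, by simp⟩
      intro i hi
      simp only [Finset.mem_erase, Finset.mem_univ, and_true]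
      rintro rfl
      exact hvX hi
  · rintro ⟨Y, Z, ⟨⟨_, hYv⟩, hZ, hZv⟩, rfl⟩
    rcases Finset.subset_singleton_iff.1 hYv with rfl | rfl
    · simpa using hZ
    · rw [← Finset.insert_eq, hmain _ (hnot Z hZv)]
      exact hZ

/-- Let `D = D(C)` be a connected odd normal binary delta-matroid.  Its twist polynomial is a
monomial iff the intersection graph `G_D` is a single vertex with a loop. -/
theorem connected_odd_monomial_graph (C : Matrix ι ι (ZMod 2)) (hC : C.IsSymm)
    (hconn : IsConnected (Finset.univ : Finset ι) (binaryFeasible C))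
    (hodd : ¬ IsEvenDM (binaryFeasible C)) :
    (∃ k : ℕ, ∀ A : Finset ι, width (twist (binaryFeasible C) A) = k) ↔
      ∃ e : ι, (Finset.univ : Finset ι) = {e} ∧ C e e = 1 := by
  constructor
  · rintro ⟨k, hk⟩
    have hconst : ∀ A, dd C A + dd C Aᶜ = dd C Finset.univ := by
      intro A
      have h1 := width_twist C hC A
      have h2 := width_twist C hC ∅
      rw [hk] at h1 h2
      rw [Finset.compl_empty, (dd_eq_zero_iff C ∅).2 (empty_feas C)] at h2
      omega
    obtain ⟨v, hv⟩ := exists_loop C hC hodd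
    have hiso := no_neighbor C hC hconst v hv
    refine ⟨v, ?_, hv⟩
    by_contra hne
    apply hconn
    refine ⟨{v}, Finset.univ.erase v, _, _, by simp, ?_, by simp, ?_,
      isDM_filter C hC _, isDM_filter C hC _, isolated_loop_sum C hC v hv hiso⟩
    · rw [Finset.nonempty_iff_ne_empty]
      intro h
      apply hne
      rw [Finset.erase_eq_empty_iff] at h
      rcases h with h | h
      · exact absurd (Finset.mem_univ v) (by rw [h]; simp)
      · exact h
    · rw [← Finset.insert_eq, Finset.insert_erase (Finset.mem_univ v)]
  · rintro ⟨e, he, hee⟩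
    refine ⟨Fintype.card ι, fun A => ?_⟩
    have hall : ∀ i : ι, i = e := fun i => by
      have := Finset.mem_univ i
      rw [he] at this
      simpa using this
    have hz : ∀ B : Finset ι, dd C B = 0 := by
      intro B
      rw [dd_eq_zero_iff, feas_iff]
      intro x hx
      funext i
      rw [hall i]
      by_cases hB : e ∈ B
      · have := hx.2 e hB
        simp only [Matrix.mulVec, dotProduct] at this
        rw [he] at this
        simpa [hee] using this
      · exact hx.1 e hB
    have := width_twist C hC A
    rw [hz, hz] at this
    simpa using this

end DeltaMatroid

end
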